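/- Let V be the vector space of symmetric 2×2 real matrices with the quadratic form Q(X) = −det X, let O(Q) ⊆ GL(V) be the group of linear automorphisms of V preserving Q, and let φ : SL(2,ℝ) → O(Q) be given by φ(A)(X) = A·X·Aᵀ. Then the image of φ equals the connected component of the identity of O(Q); in particular SL(2,ℝ) is a double cover of the identity component of the 3-dimensional Lorentz group. -/

import Mathlib

open Matrix

/-- The symmetric `2 × 2` matrix corresponding to `(v 0, v 1, v 2) ∈ ℝ³`. -/
def symOf (v : Fin 3 → ℝ) : Matrix (Fin 2) (Fin 2) ℝ := !![v 0, v 1; v 1, v 2]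

/-- The ℝ³-coordinates of a symmetric `2 × 2` matrix. -/
def vecOf (X : Matrix (Fin 2) (Fin 2) ℝ) : Fin 3 → ℝ := ![X 0 0, X 0 1, X 1 1]

/-- The Lorentzian quadratic form `Q(X) = -det X`, in the coordinates of `symOf`. -/
def qForm (v : Fin 3 → ℝ) : ℝ := -(symOf v).det

/-- The group `O(Q) ⊆ GL(V)` of linear automorphisms preserving `Q`. -/
def OQ : Subgroup (GL (Fin 3) ℝ) where
  carrier := {g | ∀ v, qForm ((g : Matrix (Fin 3) (Fin 3) ℝ) *ᵥ v) = qForm v}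
  one_mem' := by intro v; rw [Units.val_one, Matrix.one_mulVec]
  mul_mem' := by
    intro a b ha hb v
    rw [Units.val_mul, ← Matrix.mulVec_mulVec, ha, hb]
  inv_mem' := by
    intro g hg v
    have h := hg (((g⁻¹ : GL (Fin 3) ℝ) : Matrix (Fin 3) (Fin 3) ℝ) *ᵥ v)
    rw [Matrix.mulVec_mulVec, ← Units.val_mul, mul_inv_cancel, Units.val_one,
      Matrix.one_mulVec] at h
    exact h.symm

/-- `SL(2, ℝ)` is connected: every element is a product of four elementary matrices. -/
theorem connectedSpace_SL2 : ConnectedSpace (SpecialLinearGroup (Fin 2) ℝ) := by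
  let f : ℝ × ℝ × ℝ × ℝ → SpecialLinearGroup (Fin 2) ℝ := fun t ↦
    ⟨!![1, 0; t.1, 1] * !![1, t.2.1; 0, 1] * !![1, 0; t.2.2.1, 1] * !![1, t.2.2.2; 0, 1], by
      simp only [det_mul, det_fin_two_of]; ring⟩
  have hf : Continuous f := by
    refine Continuous.subtype_mk ?_ _
    refine ((Continuous.mul ?_ ?_).mul ?_).mul ?_ <;>
    · refine continuous_matrix fun i j ↦ ?_
      fin_cases i <;> fin_cases j <;> simp <;> fun_prop
  have surj_of_ne : ∀ p q r s : ℝ, p * s - r * q = 1 → q ≠ 0 →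
      !![1, (p - 1) / q; 0, 1] * !![1, 0; q, 1] * !![1, (s - 1) / q; 0, 1] = !![p, r; q, s] := by
    intro p q r s h hq
    ext i j
    fin_cases i <;> fin_cases j <;> simp <;> field_simp <;> linarith
  refine Function.Surjective.connectedSpace (f := f) (fun A ↦ ?_) hf
  have hA := A.det_coe
  rw [det_fin_two] at hA
  by_cases hq : A 1 0 = 0
  · have hp : A 0 0 ≠ 0 := fun hp ↦ by simp [hp, hq] at hA
    have key := surj_of_ne (A 0 0) (A 0 0) (A 0 1) (A 0 1 + A 1 1)
      (by linear_combination hA + (A 0 1) * hq) hp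
    refine ⟨(-1, (A 0 0 - 1) / A 0 0, A 0 0, (A 0 1 + A 1 1 - 1) / A 0 0), Subtype.ext ?_⟩
    simp only [f]
    rw [Matrix.mul_assoc !![1, 0; (-1 : ℝ), 1], Matrix.mul_assoc !![1, 0; (-1 : ℝ), 1],
      key]
    ext i j
    fin_cases i <;> fin_cases j <;> simp [hq]
  · refine ⟨(0, (A 0 0 - 1) / A 1 0, A 1 0, (A 1 1 - 1) / A 1 0), Subtype.ext ?_⟩
    simp only [f]
    rw [Matrix.mul_assoc !![1, 0; (0 : ℝ), 1], Matrix.mul_assoc !![1, 0; (0 : ℝ), 1],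
      surj_of_ne _ _ (A 0 1) _ hA hq]
    ext i j
    fin_cases i <;> fin_cases j <;> simp

/-- The matrix of `X ↦ A * X * Aᵀ` in the coordinates of `symOf`. -/
def congruenceMatrix (A : Matrix (Fin 2) (Fin 2) ℝ) : Matrix (Fin 3) (Fin 3) ℝ :=
  !![A 0 0 ^ 2, 2 * A 0 0 * A 0 1, A 0 1 ^ 2;
    A 0 0 * A 1 0, A 0 0 * A 1 1 + A 0 1 * A 1 0, A 0 1 * A 1 1;
    A 1 0 ^ 2, 2 * A 1 0 * A 1 1, A 1 1 ^ 2]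

theorem congruenceMatrix_mulVec (A : Matrix (Fin 2) (Fin 2) ℝ) (v : Fin 3 → ℝ) :
    congruenceMatrix A *ᵥ v = vecOf (A * symOf v * Aᵀ) := by
  ext i
  fin_cases i <;>
  simp [congruenceMatrix, vecOf, symOf, mulVec, dotProduct, Fin.sum_univ_three,
    Matrix.mul_apply] <;> ring

theorem symOf_vecOf_congruence (A : Matrix (Fin 2) (Fin 2) ℝ) (v : Fin 3 → ℝ) :
    symOf (vecOf (A * symOf v * Aᵀ)) = A * symOf v * Aᵀ := by
  ext i j
  fin_cases i <;> fin_cases j <;>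
  simp [vecOf, symOf, Matrix.mul_apply]
  ring

theorem congruenceMatrix_mul (A B : Matrix (Fin 2) (Fin 2) ℝ) :
    congruenceMatrix (A * B) = congruenceMatrix A * congruenceMatrix B := by
  refine Matrix.ext_of_mulVec_single fun i ↦ ?_
  rw [← mulVec_mulVec]
  simp only [congruenceMatrix_mulVec, symOf_vecOf_congruence]
  simp only [transpose_mul, Matrix.mul_assoc]

theorem congruenceMatrix_one : congruenceMatrix 1 = 1 := by
  ext i j
  fin_cases i <;> fin_cases j <;> simp [congruenceMatrix]

theorem continuous_congruenceMatrix : Continuous congruenceMatrix := by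
  refine continuous_matrix fun i j ↦ ?_
  fin_cases i <;> fin_cases j <;> simp [congruenceMatrix] <;> fun_prop

/-- The congruence morphism `SL(2, ℝ) → O(Q)`, `φ(A)(X) = A * X * Aᵀ`. -/
def congruenceHom : SpecialLinearGroup (Fin 2) ℝ →* OQ where
  toFun A :=
    ⟨⟨congruenceMatrix (A : Matrix (Fin 2) (Fin 2) ℝ),
      congruenceMatrix ((A⁻¹ : SpecialLinearGroup (Fin 2) ℝ) : Matrix (Fin 2) (Fin 2) ℝ),
      by rw [← congruenceMatrix_mul, ← congruenceMatrix_one]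
         exact congrArg (congruenceMatrix ∘ Subtype.val) (mul_inv_cancel A),
      by rw [← congruenceMatrix_mul, ← congruenceMatrix_one]
         exact congrArg (congruenceMatrix ∘ Subtype.val) (inv_mul_cancel A)⟩, fun v ↦ by
      simp [congruenceMatrix_mulVec, qForm, symOf_vecOf_congruence]⟩
  map_one' := Subtype.ext <| Units.ext <| by simpa using congruenceMatrix_one
  map_mul' A B := Subtype.ext <| Units.ext <| by simpa using congruenceMatrix_mul A B

theorem continuous_congruenceHom : Continuous congruenceHom := by
  refine Continuous.subtype_mk (Units.continuous_iff.2 ⟨?_, ?_⟩) _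
  · exact continuous_congruenceMatrix.comp continuous_subtype_val
  · exact continuous_congruenceMatrix.comp (continuous_subtype_val.comp continuous_inv)

/-- The forward light cone is the set of squares `u uᵀ`. -/
theorem exists_sq_of_mul_eq_sq {x y z : ℝ} (h : x * z = y ^ 2) (hpos : 0 < x + z) :
    ∃ p q : ℝ, x = p ^ 2 ∧ y = p * q ∧ z = q ^ 2 := by
  have hx : 0 ≤ x := by nlinarith [sq_nonneg x, sq_nonneg y]
  have hz : 0 ≤ z := by nlinarith [sq_nonneg z, sq_nonneg y]
  have hy : |y| = √x * √z := by
    rw [← Real.sqrt_mul hx, h, Real.sqrt_sq_eq_abs]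
  rcases abs_choice y with hs | hs
  · exact ⟨√x, √z, (Real.sq_sqrt hx).symm, by rw [← hy, hs], (Real.sq_sqrt hz).symm⟩
  · exact ⟨√x, -√z, (Real.sq_sqrt hx).symm, by linarith, by rw [neg_sq, Real.sq_sqrt hz]⟩

theorem eq_zero_of_mul_eq_sq {x y z : ℝ} (h : x * z = y ^ 2) (h0 : x + z = 0) :
    x = 0 ∧ y = 0 ∧ z = 0 := by
  obtain rfl : z = -x := by linarith
  have hx : x = 0 := by nlinarith [sq_nonneg x, sq_nonneg y]
  subst hx
  simpa [eq_comm] using h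

/-- Polarized form of the invariance of `qForm` on the columns of an element of `O(Q)`. -/
theorem OQ_column_relations {g : Matrix (Fin 3) (Fin 3) ℝ}
    (hg : ∀ v, qForm (g *ᵥ v) = qForm v) :
    g 0 0 * g 2 0 = g 1 0 ^ 2 ∧ g 0 2 * g 2 2 = g 1 2 ^ 2 ∧
    g 0 1 * g 2 1 - g 1 1 ^ 2 = -1 ∧
    g 0 0 * g 2 1 + g 0 1 * g 2 0 - 2 * (g 1 0 * g 1 1) = 0 ∧
    g 0 1 * g 2 2 + g 0 2 * g 2 1 - 2 * (g 1 1 * g 1 2) = 0 ∧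
    g 0 0 * g 2 2 + g 0 2 * g 2 0 - 2 * (g 1 0 * g 1 2) = 1 := by
  have h0 := hg ![1, 0, 0]
  have h1 := hg ![0, 1, 0]
  have h2 := hg ![0, 0, 1]
  have h01 := hg ![1, 1, 0]
  have h12 := hg ![0, 1, 1]
  have h02 := hg ![1, 0, 1]
  simp [qForm, symOf, mulVec, dotProduct, Fin.sum_univ_three, det_fin_two_of] at h0 h1 h2 h01 h12 h02
  refine ⟨?_, ?_, ?_, ?_, ?_, ?_⟩ <;> linarith

theorem exists_SL2_of_pos {g : Matrix (Fin 3) (Fin 3) ℝ}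
    (hg : ∀ v, qForm (g *ᵥ v) = qForm v) (hdet : 0 < g.det)
    (h0 : 0 < g 0 0 + g 2 0) (h2 : 0 < g 0 2 + g 2 2) :
    ∃ A : SpecialLinearGroup (Fin 2) ℝ, g = congruenceMatrix A := by
  obtain ⟨e0, e2, e1, e01, e12, e02⟩ := OQ_column_relations hg
  obtain ⟨p, q, hp, hpq, hq⟩ := exists_sq_of_mul_eq_sq e0 h0
  obtain ⟨r, s, hA, hr, hrs', hs⟩ : ∃ r s : ℝ, p * s - r * q = 1 ∧
      g 0 2 = r ^ 2 ∧ g 1 2 = r * s ∧ g 2 2 = s ^ 2 := by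
    obtain ⟨r, s, hr, hrs, hs⟩ := exists_sq_of_mul_eq_sq e2 h2
    have : (p * s - r * q) ^ 2 = 1 := by
      rw [hp, hpq, hq, hr, hrs, hs] at e02
      linear_combination e02
    rcases sq_eq_one_iff.1 this with h | h
    · exact ⟨r, s, h, hr, hrs, hs⟩
    · exact ⟨-r, -s, by linarith, by rw [hr]; ring, by rw [hrs]; ring, by rw [hs]; ring⟩
  set c : ℝ := g 1 1 * (p * s + r * q) - g 0 1 * (q * s) - g 2 1 * (p * r) with hc
  have hx : g 0 1 = c * (2 * p * r) := by
    rw [hp, hpq, hq] at e01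
    rw [hr, hs, hrs'] at e12
    linear_combination p ^ 2 * e12 + r ^ 2 * e01 - g 0 1 * (p * s - r * q + 1) * hA
  have hy : g 1 1 = c * (p * s + r * q) := by
    rw [hp, hpq, hq] at e01
    rw [hr, hs, hrs'] at e12
    linear_combination p * q * e12 + r * s * e01 - g 1 1 * (p * s - r * q + 1) * hA
  have hz : g 2 1 = c * (2 * q * s) := by
    rw [hp, hpq, hq] at e01
    rw [hr, hs, hrs'] at e12
    linear_combination q ^ 2 * e12 + s ^ 2 * e01 - g 2 1 * (p * s - r * q + 1) * hA
  clear_value c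
  have hc2 : c ^ 2 = 1 := by
    rw [hx, hy, hz] at e1
    linear_combination -e1 - c ^ 2 * (p * s - r * q + 1) * hA
  have hdet_eq : g.det = c := by
    rw [det_fin_three, hx, hy, hz, hp, hpq, hq, hr, hrs', hs]
    linear_combination c * ((p * s - r * q) ^ 2 + (p * s - r * q) + 1) * hA
  have hc1 : c = 1 := by
    rcases sq_eq_one_iff.1 hc2 with h | h
    · exact h
    · linarith
  refine ⟨⟨!![p, r; q, s], by rw [det_fin_two_of]; exact hA⟩, ?_⟩
  ext i j
  fin_cases i <;> fin_cases j <;> simp [congruenceMatrix, hp, hpq, hq, hr, hrs', hs, hx, hy, hz, hc1]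

/-- The elements of `O(Q)` preserving orientation and time orientation form a clopen set. -/
theorem isClopen_OQ_pos : IsClopen {g : OQ |
    0 < ((g : GL (Fin 3) ℝ) : Matrix (Fin 3) (Fin 3) ℝ).det ∧
    0 < (g : GL (Fin 3) ℝ) 0 0 + (g : GL (Fin 3) ℝ) 2 0 ∧
    0 < (g : GL (Fin 3) ℝ) 0 2 + (g : GL (Fin 3) ℝ) 2 2} := by
  have clopen_of_ne : ∀ f : OQ → ℝ, Continuous f → (∀ g, f g ≠ 0) → IsClopen {g | 0 < f g} := by
    intro f hf h0
    refine ⟨?_, isOpen_lt continuous_const hf⟩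
    simp only [lt_iff_le_and_ne, (h0 _).symm, ne_eq, not_false_eq_true, and_true]
    exact isClosed_le continuous_const hf
  have hval : Continuous fun g : OQ ↦ ((g : GL (Fin 3) ℝ) : Matrix (Fin 3) (Fin 3) ℝ) :=
    Units.continuous_val.comp continuous_subtype_val
  refine (clopen_of_ne _ hval.matrix_det fun g ↦ ?_).inter
    ((clopen_of_ne _ ((hval.matrix_elem 0 0).add (hval.matrix_elem 2 0)) fun g h ↦ ?_).inter
      (clopen_of_ne _ ((hval.matrix_elem 0 2).add (hval.matrix_elem 2 2)) fun g h ↦ ?_))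
  · exact ((isUnit_iff_isUnit_det _).1 (g : GL (Fin 3) ℝ).isUnit).ne_zero
  · obtain ⟨e0, -, -, -, -, e02⟩ := OQ_column_relations g.2
    obtain ⟨h0, h1, h2⟩ := eq_zero_of_mul_eq_sq e0 h
    simp [h0, h1, h2] at e02
  · obtain ⟨-, e2, -, -, -, e02⟩ := OQ_column_relations g.2
    obtain ⟨h0, h1, h2⟩ := eq_zero_of_mul_eq_sq e2 h
    simp [h0, h1, h2] at e02

/-- The image of the congruence morphism `φ : SL(2,ℝ) → O(Q)`, `φ(A)(X) = A·X·Aᵀ`,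
equals the connected component of the identity of `O(Q)`; in particular `SL(2,ℝ)`
is a double cover of the identity component of the 3-dimensional Lorentz group. -/
theorem SL2_image_eq_identityComponent :
    {g : OQ | ∃ A : Matrix.SpecialLinearGroup (Fin 2) ℝ,
        ∀ v : Fin 3 → ℝ,
          ((g : GL (Fin 3) ℝ) : Matrix (Fin 3) (Fin 3) ℝ) *ᵥ v
            = vecOf ((A : Matrix (Fin 2) (Fin 2) ℝ) * symOf v * (A : Matrix (Fin 2) (Fin 2) ℝ)ᵀ)}
      = connectedComponent (1 : OQ) := by
  have mem_iff : ∀ (g : OQ) (A : SpecialLinearGroup (Fin 2) ℝ),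
      (∀ v, ((g : GL (Fin 3) ℝ) : Matrix (Fin 3) (Fin 3) ℝ) *ᵥ v
        = vecOf ((A : Matrix (Fin 2) (Fin 2) ℝ) * symOf v * (A : Matrix (Fin 2) (Fin 2) ℝ)ᵀ)) ↔
      congruenceHom A = g := by
    intro g A
    simp only [← congruenceMatrix_mulVec]
    constructor
    · intro h
      exact Subtype.ext <| Units.ext <| Matrix.ext_of_mulVec_single fun i ↦ (h _).symm
    · rintro rfl v
      rfl
  simp only [mem_iff]
  apply Set.Subset.antisymm
  · have := connectedSpace_SL2
    exact (isPreconnected_range continuous_congruenceHom).subset_connectedComponent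
      ⟨1, map_one _⟩
  · refine (isClopen_OQ_pos.connectedComponent_subset (by simp)).trans ?_
    rintro g ⟨hdet, h0, h2⟩
    obtain ⟨A, hA⟩ := exists_SL2_of_pos g.2 hdet h0 h2
    exact ⟨A, Subtype.ext <| Units.ext hA.symm⟩
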